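/- Let ξ₀, ξ₁₂ : ℂ → ℂ be holomorphic functions with no common zero, and let J be the warped product structure on ℝ⁶ determined by (ξ₀, ξ₁₂). Then J is an orthogonal complex structure globally defined on ℝ⁶: for every x ∈ ℝ⁶ one has J(x)ᵀJ(x) = I and J(x)² = −I, and the Nijenhuis tensor of J vanishes identically on ℝ⁶. -/

import Mathlib

open Matrix Filter

attribute [local instance] Matrix.normedAddCommGroup Matrix.normedSpace

/-- The Nijenhuis tensor of a matrix-valued map `J`. -/
noncomputable def nijenhuis {ι : Type*} [Fintype ι]
    (J : (ι → ℝ) → Matrix ι ι ℝ) (x v w : ι → ℝ) : ι → ℝ :=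
  (fderiv ℝ J x ((J x).mulVec v)).mulVec w
    - (fderiv ℝ J x ((J x).mulVec w)).mulVec v
    + (J x).mulVec ((fderiv ℝ J x w).mulVec v)
    - (J x).mulVec ((fderiv ℝ J x v).mulVec w)

/-- The warped product almost complex structure on `ℝ⁶ = ℂ³` (real coordinates ordered
`(x₁,y₁,x₂,y₂,x₃,y₃)`) determined by `(ξ₀, ξ₁₂)`: block diagonal `J₁(z₃) ⊕ J₀`. -/
noncomputable def wpsJ (ξ₀ ξ₁₂ : ℂ → ℂ) (x : Fin 6 → ℝ) : Matrix (Fin 6) (Fin 6) ℝ :=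
  let z : ℂ := (x 4 : ℂ) + (x 5 : ℂ) * Complex.I
  let a : ℝ := Complex.normSq (ξ₀ z)
  let b : ℝ := Complex.normSq (ξ₁₂ z)
  let f : ℝ := ((starRingEnd ℂ) (ξ₀ z) * ξ₁₂ z).re
  let g : ℝ := ((starRingEnd ℂ) (ξ₀ z) * ξ₁₂ z).im
  (a + b)⁻¹ • !![0, b - a, -(2*g), 2*f, 0, 0;
                 a - b, 0, 2*f, 2*g, 0, 0;
                 2*g, -(2*f), 0, b - a, 0, 0;
                 -(2*f), -(2*g), a - b, 0, 0, 0;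
                 0, 0, 0, 0, 0, -(a + b);
                 0, 0, 0, 0, a + b, 0]

/-- The warped product structure in terms of `ξ₀ = p + q i` and `ξ₁₂ = r + s i`, multiplied by
`|ξ₀|² + |ξ₁₂|²`. -/
def wpsNum (p q r s : ℝ) : Matrix (Fin 6) (Fin 6) ℝ :=
  !![0, r*r + s*s - (p*p + q*q), -(2*(p*s - q*r)), 2*(p*r + q*s), 0, 0;
     p*p + q*q - (r*r + s*s), 0, 2*(p*r + q*s), 2*(p*s - q*r), 0, 0;
     2*(p*s - q*r), -(2*(p*r + q*s)), 0, r*r + s*s - (p*p + q*q), 0, 0;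
     -(2*(p*r + q*s)), -(2*(p*s - q*r)), p*p + q*q - (r*r + s*s), 0, 0, 0;
     0, 0, 0, 0, 0, -(p*p + q*q + (r*r + s*s));
     0, 0, 0, 0, p*p + q*q + (r*r + s*s), 0]

/-- The differential of `wpsNum` at `(p, q, r, s)` in the direction `(p', q', r', s')`. -/
def wpsNumDeriv (p q r s p' q' r' s' : ℝ) : Matrix (Fin 6) (Fin 6) ℝ :=
  let a' := 2*(p*p' + q*q')
  let b' := 2*(r*r' + s*s')
  let f' := p'*r + p*r' + (q'*s + q*s')
  let g' := p'*s + p*s' - (q'*r + q*r')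
  !![0, b' - a', -(2*g'), 2*f', 0, 0;
     a' - b', 0, 2*f', 2*g', 0, 0;
     2*g', -(2*f'), 0, b' - a', 0, 0;
     -(2*f'), -(2*g'), a' - b', 0, 0, 0;
     0, 0, 0, 0, 0, -(a' + b');
     0, 0, 0, 0, a' + b', 0]

/-- The differential of `(p² + q² + r² + s²)⁻¹ • wpsNum p q r s`. -/
noncomputable def wpsDeriv (p q r s p' q' r' s' : ℝ) : Matrix (Fin 6) (Fin 6) ℝ :=
  (p*p + q*q + (r*r + s*s))⁻¹ • wpsNumDeriv p q r s p' q' r' s'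
    - (2*(p*p' + q*q' + (r*r' + s*s')) * ((p*p + q*q + (r*r + s*s))⁻¹)^2) • wpsNum p q r s

theorem wpsJ_eq (ξ₀ ξ₁₂ : ℂ → ℂ) (x : Fin 6 → ℝ) (z : ℂ)
    (hz : z = (x 4 : ℂ) + (x 5 : ℂ) * Complex.I) :
    wpsJ ξ₀ ξ₁₂ x =
      ((ξ₀ z).re * (ξ₀ z).re + (ξ₀ z).im * (ξ₀ z).im
        + ((ξ₁₂ z).re * (ξ₁₂ z).re + (ξ₁₂ z).im * (ξ₁₂ z).im))⁻¹ •
      wpsNum (ξ₀ z).re (ξ₀ z).im (ξ₁₂ z).re (ξ₁₂ z).im := by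
  subst hz
  simp only [wpsJ, wpsNum, Complex.normSq_apply, Complex.mul_re, Complex.mul_im,
    Complex.conj_re, Complex.conj_im, neg_mul, sub_neg_eq_add, ← sub_eq_add_neg]

theorem wpsNum_transpose (p q r s : ℝ) : (wpsNum p q r s)ᵀ = -wpsNum p q r s := by
  ext i j
  fin_cases i <;> fin_cases j <;> simp [wpsNum]

theorem wpsNum_mul_self (p q r s : ℝ) :
    wpsNum p q r s * wpsNum p q r s = -((p*p + q*q + (r*r + s*s))^2 • 1) := by
  ext i j
  fin_cases i <;> fin_cases j <;>
    simp [wpsNum, Matrix.mul_apply, Fin.sum_univ_six] <;> ring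

set_option maxHeartbeats 1600000 in
theorem wpsNum_mul_wpsNumDeriv (p q r s c d e f : ℝ) :
    wpsNum p q r s * wpsNumDeriv p q r s c d e f
        + (2*(p*c + q*d + (r*e + s*f)) * (p*p + q*q + (r*r + s*s))) • 1 =
      (p*p + q*q + (r*r + s*s)) • wpsNumDeriv p q r s (-d) c (-f) e
        - (2*(p*(-d) + q*c + (r*(-f) + s*e))) • wpsNum p q r s := by
  ext i j
  fin_cases i <;> fin_cases j <;>
    simp [wpsNum, wpsNumDeriv] <;> ring

/-- The Cauchy-Riemann equation satisfied by the normalized structure. -/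
theorem wpsDeriv_rotate {p q r s : ℝ} (h : p*p + q*q + (r*r + s*s) ≠ 0) (c d e f : ℝ) :
    wpsDeriv p q r s (-d) c (-f) e =
      ((p*p + q*q + (r*r + s*s))⁻¹ • wpsNum p q r s) * wpsDeriv p q r s c d e f := by
  have key := wpsNum_mul_wpsNumDeriv p q r s c d e f
  have sq := wpsNum_mul_self p q r s
  unfold wpsDeriv
  generalize p*p + q*q + (r*r + s*s) = ρ at *
  generalize 2*(p*(-d) + q*c + (r*(-f) + s*e)) = τ at *
  generalize 2*(p*c + q*d + (r*e + s*f)) = σ at *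
  rw [mul_sub, smul_mul_smul_comm, smul_mul_smul_comm, sq, eq_sub_of_add_eq key]
  match_scalars <;> field_simp <;> ring

set_option maxHeartbeats 1600000 in
theorem wpsDeriv_linear (p q r s c d e f k l : ℝ) :
    wpsDeriv p q r s (k*c - l*d) (k*d + l*c) (k*e - l*f) (k*f + l*e) =
      k • wpsDeriv p q r s c d e f + l • wpsDeriv p q r s (-d) c (-f) e := by
  ext i j
  fin_cases i <;> fin_cases j <;> simp [wpsDeriv, wpsNum, wpsNumDeriv] <;> ring

theorem hasDerivAt_wpsNum {p q r s : ℝ → ℝ} {p' q' r' s' t : ℝ}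
    (hp : HasDerivAt p p' t) (hq : HasDerivAt q q' t)
    (hr : HasDerivAt r r' t) (hs : HasDerivAt s s' t) :
    HasDerivAt (fun t => wpsNum (p t) (q t) (r t) (s t))
      (wpsNumDeriv (p t) (q t) (r t) (s t) p' q' r' s') t := by
  have ha := (hp.mul hp).add (hq.mul hq)
  have hb := (hr.mul hr).add (hs.mul hs)
  have hf := ((hp.mul hr).add (hq.mul hs)).const_mul 2
  have hg := ((hp.mul hs).sub (hq.mul hr)).const_mul 2
  refine hasDerivAt_pi.2 fun i => hasDerivAt_pi.2 fun j => ?_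
  fin_cases i <;> fin_cases j <;>
    first
    | exact hasDerivAt_const t (0 : ℝ)
    | exact (hb.sub ha).congr_deriv (by simp [wpsNumDeriv]; ring)
    | exact (ha.sub hb).congr_deriv (by simp [wpsNumDeriv]; ring)
    | exact (ha.add hb).congr_deriv (by simp [wpsNumDeriv]; ring)
    | exact (ha.add hb).neg.congr_deriv (by simp [wpsNumDeriv]; ring)
    | exact hf.congr_deriv (by simp [wpsNumDeriv])
    | exact hg.congr_deriv (by simp [wpsNumDeriv])
    | exact hf.neg.congr_deriv (by simp [wpsNumDeriv])
    | exact hg.neg.congr_deriv (by simp [wpsNumDeriv])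

theorem hasDerivAt_inv_smul_wpsNum {p q r s : ℝ → ℝ} {p' q' r' s' t : ℝ}
    (hp : HasDerivAt p p' t) (hq : HasDerivAt q q' t)
    (hr : HasDerivAt r r' t) (hs : HasDerivAt s s' t)
    (h : p t * p t + q t * q t + (r t * r t + s t * s t) ≠ 0) :
    HasDerivAt (fun t => (p t * p t + q t * q t + (r t * r t + s t * s t))⁻¹ •
        wpsNum (p t) (q t) (r t) (s t))
      (wpsDeriv (p t) (q t) (r t) (s t) p' q' r' s') t := by
  have hρ := (((hp.mul hp).add (hq.mul hq)).add ((hr.mul hr).add (hs.mul hs))).inv h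
  refine (hρ.smul (hasDerivAt_wpsNum hp hq hr hs)).congr_deriv ?_
  simp only [wpsDeriv, Pi.add_apply, Pi.mul_apply, Pi.inv_apply]
  match_scalars <;> field_simp <;> ring

theorem differentiable_wpsNum {E : Type*} [NormedAddCommGroup E] [NormedSpace ℝ E]
    {p q r s : E → ℝ} (hp : Differentiable ℝ p) (hq : Differentiable ℝ q)
    (hr : Differentiable ℝ r) (hs : Differentiable ℝ s) :
    Differentiable ℝ (fun x => wpsNum (p x) (q x) (r x) (s x)) := by
  refine differentiable_pi.2 fun i => differentiable_pi.2 fun j => ?_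
  fin_cases i <;> fin_cases j <;> simp [wpsNum] <;> fun_prop

theorem sum_sq_ne_zero {z w : ℂ} (h : ¬(z = 0 ∧ w = 0)) :
    z.re * z.re + z.im * z.im + (w.re * w.re + w.im * w.im) ≠ 0 := by
  rw [← Complex.normSq_apply, ← Complex.normSq_apply]
  intro h0
  have h1 := Complex.normSq_nonneg z
  have h2 := Complex.normSq_nonneg w
  exact h ⟨Complex.normSq_eq_zero.1 (by linarith), Complex.normSq_eq_zero.1 (by linarith)⟩

theorem differentiable_wpsJ {ξ₀ ξ₁₂ : ℂ → ℂ} (h₀ : Differentiable ℂ ξ₀)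
    (h₁₂ : Differentiable ℂ ξ₁₂) (hnz : ∀ z : ℂ, ¬(ξ₀ z = 0 ∧ ξ₁₂ z = 0)) :
    Differentiable ℝ (wpsJ ξ₀ ξ₁₂) := by
  have hz : Differentiable ℝ fun x : Fin 6 → ℝ => (x 4 : ℂ) + (x 5 : ℂ) * Complex.I :=
    (Complex.ofRealCLM.differentiable.comp (differentiable_apply 4)).add
      ((Complex.ofRealCLM.differentiable.comp (differentiable_apply 5)).mul_const _)
  have d₀ := (h₀.restrictScalars ℝ).comp hz
  have d₁₂ := (h₁₂.restrictScalars ℝ).comp hz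
  have hp := Complex.reCLM.differentiable.comp d₀
  have hq := Complex.imCLM.differentiable.comp d₀
  have hr := Complex.reCLM.differentiable.comp d₁₂
  have hs := Complex.imCLM.differentiable.comp d₁₂
  rw [funext fun x => wpsJ_eq ξ₀ ξ₁₂ x _ rfl]
  exact ((((hp.mul hp).add (hq.mul hq)).add ((hr.mul hr).add (hs.mul hs))).inv
    fun x => sum_sq_ne_zero (hnz _)).smul (differentiable_wpsNum hp hq hr hs)

/-- The differential of the warped product structure is complex linear in `z₃`. -/
theorem exists_fderiv_wpsJ {ξ₀ ξ₁₂ : ℂ → ℂ} (h₀ : Differentiable ℂ ξ₀)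
    (h₁₂ : Differentiable ℂ ξ₁₂) (hnz : ∀ z : ℂ, ¬(ξ₀ z = 0 ∧ ξ₁₂ z = 0)) (x : Fin 6 → ℝ) :
    ∃ A : Matrix (Fin 6) (Fin 6) ℝ, ∀ u : Fin 6 → ℝ,
      fderiv ℝ (wpsJ ξ₀ ξ₁₂) x u = u 4 • A + u 5 • (wpsJ ξ₀ ξ₁₂ x * A) := by
  set z : ℂ := (x 4 : ℂ) + (x 5 : ℂ) * Complex.I with hz
  refine ⟨wpsDeriv (ξ₀ z).re (ξ₀ z).im (ξ₁₂ z).re (ξ₁₂ z).im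
    (deriv ξ₀ z).re (deriv ξ₀ z).im (deriv ξ₁₂ z).re (deriv ξ₁₂ z).im, fun u => ?_⟩
  rw [wpsJ_eq ξ₀ ξ₁₂ x z hz, ← wpsDeriv_rotate (sum_sq_ne_zero (hnz z)), ← wpsDeriv_linear]
  set k : ℂ := (u 4 : ℂ) + (u 5 : ℂ) * Complex.I with hk
  have hline : HasDerivAt (fun t : ℝ => z + (t : ℂ) * k) k 0 := by
    simpa using ((Complex.ofRealCLM.hasDerivAt (x := (0 : ℝ))).mul_const k).const_add z
  have hcomp : ∀ {ξ : ℂ → ℂ}, Differentiable ℂ ξ →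
      HasDerivAt (fun t : ℝ => ξ (z + (t : ℂ) * k)) (deriv ξ z * k) 0 := fun {ξ} h => by
    have h' : HasDerivAt ξ (deriv ξ z) (z + ((0 : ℝ) : ℂ) * k) := by
      simpa using (h z).hasDerivAt
    exact h'.comp (0 : ℝ) hline
  have hre : ∀ {γ : ℝ → ℂ} {γ' : ℂ}, HasDerivAt γ γ' 0 →
      HasDerivAt (fun t => (γ t).re) γ'.re 0 := fun h =>
    Complex.reCLM.hasFDerivAt.comp_hasDerivAt _ h
  have him : ∀ {γ : ℝ → ℂ} {γ' : ℂ}, HasDerivAt γ γ' 0 →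
      HasDerivAt (fun t => (γ t).im) γ'.im 0 := fun h =>
    Complex.imCLM.hasFDerivAt.comp_hasDerivAt _ h
  have hJ := hasDerivAt_inv_smul_wpsNum (hre (hcomp h₀)) (him (hcomp h₀))
    (hre (hcomp h₁₂)) (him (hcomp h₁₂)) (sum_sq_ne_zero (hnz _))
  have hcurve : HasDerivAt (fun t : ℝ => x + t • u) u 0 := by
    simpa using ((hasDerivAt_id (0 : ℝ)).smul_const u).const_add x
  have hx : HasFDerivAt (wpsJ ξ₀ ξ₁₂) (fderiv ℝ (wpsJ ξ₀ ξ₁₂) x) (x + (0 : ℝ) • u) := by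
    simpa using (differentiable_wpsJ h₀ h₁₂ hnz x).hasFDerivAt
  have hJ' := hx.comp_hasDerivAt (0 : ℝ) hcurve
  have heq : wpsJ ξ₀ ξ₁₂ ∘ (fun t : ℝ => x + t • u) = _ :=
    funext fun t => wpsJ_eq ξ₀ ξ₁₂ (x + t • u) (z + (t : ℂ) * k) (by
      simp only [hz, hk, Pi.add_apply, Pi.smul_apply, smul_eq_mul]
      push_cast
      ring)
  rw [heq] at hJ'
  refine (hJ'.unique hJ).trans ?_
  congr 1 <;> simp [hk] <;> ring

theorem wpsJ_mul_self {ξ₀ ξ₁₂ : ℂ → ℂ} (hnz : ∀ z : ℂ, ¬(ξ₀ z = 0 ∧ ξ₁₂ z = 0))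
    (x : Fin 6 → ℝ) : wpsJ ξ₀ ξ₁₂ x * wpsJ ξ₀ ξ₁₂ x = -1 := by
  have h := sum_sq_ne_zero (hnz ((x 4 : ℂ) + (x 5 : ℂ) * Complex.I))
  rw [wpsJ_eq ξ₀ ξ₁₂ x _ rfl, smul_mul_smul_comm, wpsNum_mul_self, smul_neg, smul_smul]
  rw [show ∀ ρ : ℝ, ρ⁻¹ * ρ⁻¹ * ρ ^ 2 = (ρ⁻¹ * ρ) ^ 2 by intro; ring, inv_mul_cancel₀ h]
  simp

theorem wpsJ_transpose (ξ₀ ξ₁₂ : ℂ → ℂ) (x : Fin 6 → ℝ) :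
    (wpsJ ξ₀ ξ₁₂ x)ᵀ = -wpsJ ξ₀ ξ₁₂ x := by
  rw [wpsJ_eq ξ₀ ξ₁₂ x _ rfl, transpose_smul, wpsNum_transpose, smul_neg]

theorem wpsJ_mulVec_four_five {ξ₀ ξ₁₂ : ℂ → ℂ} (hnz : ∀ z : ℂ, ¬(ξ₀ z = 0 ∧ ξ₁₂ z = 0))
    (x v : Fin 6 → ℝ) :
    (wpsJ ξ₀ ξ₁₂ x).mulVec v 4 = -v 5 ∧ (wpsJ ξ₀ ξ₁₂ x).mulVec v 5 = v 4 := by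
  have h := sum_sq_ne_zero (hnz ((x 4 : ℂ) + (x 5 : ℂ) * Complex.I))
  rw [wpsJ_eq ξ₀ ξ₁₂ x _ rfl, smul_mulVec]
  constructor <;>
    simp only [Pi.smul_apply, smul_eq_mul] <;>
    rw [inv_mul_eq_iff_eq_mul₀ h] <;>
    simp [wpsNum, mulVec, dotProduct, Fin.sum_univ_six] <;> ring

/-- The warped product structure determined by holomorphic `ξ₀, ξ₁₂` with no common zero
is a globally defined orthogonal complex structure on `ℝ⁶`. -/
theorem warped_product_is_OCS (ξ₀ ξ₁₂ : ℂ → ℂ)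
    (h₀ : Differentiable ℂ ξ₀) (h₁₂ : Differentiable ℂ ξ₁₂)
    (hnz : ∀ z : ℂ, ¬(ξ₀ z = 0 ∧ ξ₁₂ z = 0)) :
    (∀ x : Fin 6 → ℝ, (wpsJ ξ₀ ξ₁₂ x)ᵀ * wpsJ ξ₀ ξ₁₂ x = 1) ∧
    (∀ x : Fin 6 → ℝ, wpsJ ξ₀ ξ₁₂ x * wpsJ ξ₀ ξ₁₂ x = -1) ∧
    (∀ (x v w : Fin 6 → ℝ), nijenhuis (wpsJ ξ₀ ξ₁₂) x v w = 0) := by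
  refine ⟨fun x => ?_, wpsJ_mul_self hnz, fun x v w => ?_⟩
  · rw [wpsJ_transpose, neg_mul, wpsJ_mul_self hnz, neg_neg]
  · obtain ⟨A, hA⟩ := exists_fderiv_wpsJ h₀ h₁₂ hnz x
    obtain ⟨hv₄, hv₅⟩ := wpsJ_mulVec_four_five hnz x v
    obtain ⟨hw₄, hw₅⟩ := wpsJ_mulVec_four_five hnz x w
    have hsq : ∀ y, (wpsJ ξ₀ ξ₁₂ x).mulVec ((wpsJ ξ₀ ξ₁₂ x).mulVec y) = -y := fun y => by
      rw [mulVec_mulVec, wpsJ_mul_self hnz, neg_mulVec, one_mulVec]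
    simp only [nijenhuis, hA, hv₄, hv₅, hw₄, hw₅, add_mulVec, smul_mulVec, mulVec_add,
      mulVec_smul, ← mulVec_mulVec, hsq]
    module
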